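/- In the ladder graph P_2 □ P_n, for 1 < k < n and i ∈ {1,2}, the node resistance curvature of the vertex (i,k) equals −(1/2) · ((α_{k−1} + 1)(α_{n−k} + 1) − 3) / ((α_{k−1} + 3)(α_{n−k} + 3) − 1), where α_m is the effective resistance across the first rung of P_2 □ P_m. -/

import Mathlib

open Classical Matrix

/-- The four Penrose conditions characterizing the Moore–Penrose pseudoinverse
of a real square matrix. -/
def IsMoorePenroseInverse {V : Type*} [Fintype V] [DecidableEq V]
    (L P : Matrix V V ℝ) : Prop :=
  L * P * L = L ∧ P * L * P = P ∧ (L * P)ᵀ = L * P ∧ (P * L)ᵀ = P * L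

/-- The Moore–Penrose pseudoinverse of a real square matrix. -/
noncomputable def pinv {V : Type*} [Fintype V] [DecidableEq V]
    (L : Matrix V V ℝ) : Matrix V V ℝ :=
  if h : ∃ P, IsMoorePenroseInverse L P then h.choose else 0

/-- Effective resistance between `x` and `y` computed from a (weighted) Laplacian `L`. -/
noncomputable def effResM {V : Type*} [Fintype V] [DecidableEq V]
    (L : Matrix V V ℝ) (x y : V) : ℝ :=
  pinv L x x + pinv L y y - 2 * pinv L x y

/-- Effective resistance between vertices `x` and `y` of a simple graph `G`. -/
noncomputable def effRes {V : Type*} [Fintype V] [DecidableEq V]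
    (G : SimpleGraph V) (x y : V) : ℝ :=
  effResM (G.lapMatrix ℝ) x y

/-- The node resistance curvature `p_x = 1 - (1/2) ∑_{y ~ x} ω_{x,y}`. -/
noncomputable def curv {V : Type*} [Fintype V] [DecidableEq V]
    (G : SimpleGraph V) (x : V) : ℝ :=
  1 - (1/2) * ∑ y : V, if G.Adj x y then effRes G x y else 0

/-- The grid graph `P_m □ P_n` (vertex `(i,j)` of the paper corresponds to
`(⟨i-1⟩, ⟨j-1⟩) : Fin m × Fin n`). -/
def grid (m n : ℕ) : SimpleGraph (Fin m × Fin n) :=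
  (SimpleGraph.pathGraph m).boxProd (SimpleGraph.pathGraph n)

/-- The ladder graph `P_2 □ P_n` (vertex `(i,k)` of the paper corresponds to
`(⟨i-1⟩, ⟨k-1⟩) : Fin 2 × Fin n`). -/
def ladder (n : ℕ) : SimpleGraph (Fin 2 × Fin n) :=
  (SimpleGraph.pathGraph 2).boxProd (SimpleGraph.pathGraph n)

/-- `α_n`, the effective resistance across the first rung of the ladder `P_2 □ P_n`,
i.e. between the vertices `(1,1)` and `(2,1)` of the paper (junk value `0` for `n = 0`). -/
noncomputable def alpha (n : ℕ) : ℝ :=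
  if h : 0 < n then effRes (ladder n) (0, ⟨0, h⟩) (1, ⟨0, h⟩) else 0

theorem exists_mp {V : Type*} [Fintype V] [DecidableEq V] (L : Matrix V V ℝ)
    (hL : Lᵀ = L) : ∃ P, IsMoorePenroseInverse L P := by
  have hH : L.IsHermitian := by
    rw [Matrix.IsHermitian, Matrix.conjTranspose_eq_transpose_of_trivial, hL]
  obtain ⟨U, d, hU1, hU⟩ : ∃ (U : Matrix V V ℝ) (d : V → ℝ), Uᵀ * U = 1 ∧
      L = U * Matrix.diagonal d * Uᵀ := by
    refine ⟨hH.eigenvectorUnitary, hH.eigenvalues, ?_, ?_⟩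
    · have := Unitary.coe_star_mul_self hH.eigenvectorUnitary
      rwa [Matrix.star_eq_conjTranspose,
        Matrix.conjTranspose_eq_transpose_of_trivial] at this
    · have := hH.spectral_theorem
      rw [Unitary.conjStarAlgAut_apply, Matrix.star_eq_conjTranspose,
        Matrix.conjTranspose_eq_transpose_of_trivial] at this
      exact this
  have key : ∀ a b : V → ℝ, (U * Matrix.diagonal a * Uᵀ) * (U * Matrix.diagonal b * Uᵀ)
      = U * Matrix.diagonal (fun i => a i * b i) * Uᵀ := by
    intro a b
    rw [← Matrix.diagonal_mul_diagonal]
    calc _ = U * Matrix.diagonal a * (Uᵀ * U) * Matrix.diagonal b * Uᵀ := by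
          simp only [Matrix.mul_assoc]
      _ = _ := by rw [hU1]; simp only [Matrix.mul_assoc, Matrix.mul_one, Matrix.one_mul]
  have keyT : ∀ a : V → ℝ, (U * Matrix.diagonal a * Uᵀ)ᵀ = U * Matrix.diagonal a * Uᵀ := by
    intro a
    simp [Matrix.transpose_mul, Matrix.mul_assoc]
  refine ⟨U * Matrix.diagonal (fun i => (d i)⁻¹) * Uᵀ, ?_⟩
  rw [hU]
  refine ⟨?_, ?_, ?_, ?_⟩
  · rw [key, key]; congr 3; ext i; simp
  · rw [key, key]; congr 3; ext i
    by_cases h : d i = 0 <;> simp [h]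
  · rw [key, keyT]
  · rw [key, keyT]

theorem pinv_spec {V : Type*} [Fintype V] [DecidableEq V] (L : Matrix V V ℝ)
    (hL : Lᵀ = L) : IsMoorePenroseInverse L (pinv L) := by
  have h := exists_mp L hL
  rw [pinv, dif_pos h]
  exact h.choose_spec

theorem pinv_symm {V : Type*} [Fintype V] [DecidableEq V] (L : Matrix V V ℝ)
    (hL : Lᵀ = L) : (pinv L)ᵀ = pinv L := by
  obtain ⟨h1, h2, h3, h4⟩ := pinv_spec L hL
  generalize pinv L = P at *
  rw [Matrix.transpose_mul, hL] at h3 h4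
  have hc : L * P = P * L := by
    have e1 : (L * P) * (P * L) = P * L := by
      rw [← h4]
      calc L * P * (L * Pᵀ) = (L * P * L) * Pᵀ := by simp only [Matrix.mul_assoc]
        _ = _ := by rw [h1]
    have e2 : (L * P) * (P * L) = L * P := by
      rw [← h3]
      calc Pᵀ * L * (P * L) = Pᵀ * (L * P * L) := by simp only [Matrix.mul_assoc]
        _ = _ := by rw [h1]
    rw [← e2, e1]
  have h2' : Pᵀ * L * Pᵀ = Pᵀ := by
    have := congrArg Matrix.transpose h2
    rwa [Matrix.transpose_mul, Matrix.transpose_mul, hL, ← Matrix.mul_assoc] at this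
  calc Pᵀ = Pᵀ * L * Pᵀ := h2'.symm
    _ = Pᵀ * (L * P) := by rw [Matrix.mul_assoc, h4, hc]
    _ = L * P * P := by rw [← Matrix.mul_assoc, h3]
    _ = P := by rw [hc, h2]

theorem effRes_of_potential {V : Type*} [Fintype V] [DecidableEq V] (G : SimpleGraph V)
    (f : V → ℝ) (x y : V)
    (h : ∀ v, (∑ w, if G.Adj v w then f v - f w else 0)
      = (if v = x then 1 else 0) - (if v = y then 1 else 0)) :
    effRes G x y = f x - f y := by
  unfold effRes effResM
  have hL : (G.lapMatrix ℝ)ᵀ = G.lapMatrix ℝ := G.isSymm_lapMatrix ℝ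
  have hf : G.lapMatrix ℝ *ᵥ f = Pi.single x 1 - Pi.single y 1 := by
    ext v
    rw [SimpleGraph.lapMatrix_mulVec_apply]
    have := h v
    simp only [Pi.sub_apply, Pi.single_apply]
    rw [← this, ← Finset.sum_filter, Finset.sum_sub_distrib, Finset.sum_const,
      ← SimpleGraph.card_neighborFinset_eq_degree, SimpleGraph.neighborFinset_eq_filter,
      nsmul_eq_mul]
  have hP := pinv_spec _ hL
  have hs := pinv_symm _ hL
  generalize pinv (G.lapMatrix ℝ) = P at *
  generalize G.lapMatrix ℝ = L at *
  have hxy : P y x = P x y := by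
    conv_lhs => rw [← hs]
    rfl
  have e1 : (L *ᵥ f) ⬝ᵥ (P *ᵥ (L *ᵥ f)) = P x x + P y y - 2 * P x y := by
    rw [hf]
    simp [Matrix.mulVec_sub, hxy]
    ring
  have e2 : (L *ᵥ f) ⬝ᵥ (P *ᵥ (L *ᵥ f)) = f x - f y := by
    have : (L *ᵥ f) = f ᵥ* L := by
      conv_rhs => rw [← hL]
      rw [Matrix.vecMul_transpose]
    conv_lhs => arg 1; rw [this]
    rw [← Matrix.dotProduct_mulVec, Matrix.mulVec_mulVec, Matrix.mulVec_mulVec,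
       hP.1, hf]
    simp [dotProduct_sub]
  rw [← e1, e2]

theorem ladder_sum (n : ℕ) (F : Fin 2 × Fin n → ℝ) (i : Fin 2) (j : ℕ) (hj : j < n) :
    (∑ w, if (ladder n).Adj (i, ⟨j, hj⟩) w then F w else 0)
      = F (1 - i, ⟨j, hj⟩) + (if h : j + 1 < n then F (i, ⟨j + 1, h⟩) else 0)
        + (if h : 0 < j then F (i, ⟨j - 1, by omega⟩) else 0) := by
  have hadj : ∀ w : Fin 2 × Fin n, (if (ladder n).Adj (i, ⟨j, hj⟩) w then F w else 0)
      = (if w = (1 - i, ⟨j, hj⟩) then F w else 0)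
        + (if w.1 = i ∧ j + 1 = w.2.val then F w else 0)
        + (if w.1 = i ∧ w.2.val + 1 = j then F w else 0) := by
    rintro ⟨i', j'⟩
    simp only [ladder, SimpleGraph.boxProd_adj, SimpleGraph.pathGraph_adj, Prod.mk.injEq,
      Fin.ext_iff]
    have : ((1 - i : Fin 2) : ℕ) = 1 - (i : ℕ) := by fin_cases i <;> rfl
    rw [this]
    have := i.2
    have := i'.2
    split_ifs <;> first | omega | simp
  simp only [hadj, Finset.sum_add_distrib]
  congr 1
  · congr 1
    · simp
    · split_ifs with h
      · rw [Finset.sum_eq_single (i, ⟨j + 1, h⟩)]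
        · simp
        · rintro ⟨i', j'⟩ _ hne
          rw [if_neg]
          rintro ⟨h1, h2⟩
          exact hne (Prod.ext h1 (Fin.ext h2.symm))
        · simp
      · apply Finset.sum_eq_zero
        rintro ⟨i', j'⟩ _
        rw [if_neg]
        rintro ⟨h1, h2⟩
        have := j'.2
        simp only at h2
        omega
  · split_ifs with h
    · rw [Finset.sum_eq_single (i, ⟨j - 1, by omega⟩)]
      · rw [if_pos]
        refine ⟨rfl, ?_⟩
        simp only
        omega
      · rintro ⟨i', j'⟩ _ hne
        rw [if_neg]
        rintro ⟨h1, h2⟩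
        refine hne (Prod.ext h1 (Fin.ext ?_))
        simp only at h2 ⊢
        omega
      · simp
    · apply Finset.sum_eq_zero
      rintro ⟨i', j'⟩ _
      rw [if_neg]
      rintro ⟨h1, h2⟩
      omega

/-- The recurrence solution. -/
noncomputable def seqU : ℕ → ℝ
  | 0 => 1
  | 1 => 1
  | (m + 2) => 4 * seqU (m + 1) - seqU m

theorem seqU_rec (m : ℕ) : seqU (m + 2) = 4 * seqU (m + 1) - seqU m := rfl

theorem seqU_pos (m : ℕ) : 0 < seqU m ∧ seqU m ≤ seqU (m + 1) := by
  induction m with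
  | zero => simp [seqU]
  | succ m ih =>
    have := seqU_rec m
    constructor <;> linarith [ih.1, ih.2]

theorem seqU_lt (m : ℕ) : seqU (m + 1) < seqU (m + 2) := by
  have := seqU_rec m
  linarith [(seqU_pos m).1, (seqU_pos m).2]

/-- Laplacian of the path. -/
noncomputable def pathD (n : ℕ) (g : ℕ → ℝ) (j : ℕ) : ℝ :=
  (if j + 1 < n then g j - g (j + 1) else 0) + (if 0 < j then g j - g (j - 1) else 0)

theorem ladder_pot (n : ℕ) (i : Fin 2) (g s : ℕ → ℝ) (x y : Fin 2 × Fin n)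
    (h : ∀ i' : Fin 2, ∀ j (hj : j < n),
      (if i' = i then 1 else -1) * (2 * g j + pathD n g j) + pathD n s j
      = (if (i', (⟨j, hj⟩ : Fin n)) = x then 1 else 0)
        - (if (i', (⟨j, hj⟩ : Fin n)) = y then 1 else 0)) :
    effRes (ladder n) x y = ((if x.1 = i then 1 else -1) * g x.2 + s x.2)
      - ((if y.1 = i then 1 else -1) * g y.2 + s y.2) := by
  refine effRes_of_potential (ladder n)
    (fun v => (if v.1 = i then 1 else -1) * g v.2 + s v.2) x y ?_
  rintro ⟨i', j, hj⟩
  rw [ladder_sum n (fun w => ((if i' = i then 1 else -1) * g j + s j) -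
    ((if w.1 = i then 1 else -1) * g w.2 + s w.2)) i' j hj]
  rw [← h i' j hj]
  have : (if 1 - i' = i then (1:ℝ) else -1) = - (if i' = i then 1 else -1) := by
    fin_cases i <;> fin_cases i' <;> simp
  simp only [this, pathD]
  split_ifs <;> ring

theorem sol_rung (n p : ℕ) (hp : p < n) (A B : ℝ) (h1 : A * seqU (p + 1) = B * seqU (n - p))
    (h2 : A * seqU (p + 2) - B * seqU (n - p - 1) = 1) (j : ℕ) (hj : j < n) :
    2 * (fun j => if j ≤ p then A * seqU (j + 1) else B * seqU (n - j)) j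
      + pathD n (fun j => if j ≤ p then A * seqU (j + 1) else B * seqU (n - j)) j
      = if j = p then 1 else 0 := by
  have hU0 : seqU 1 = seqU 0 := by simp [seqU]
  have hr := seqU_rec
  obtain ⟨q, rfl⟩ : ∃ q, n = p + q + 1 := ⟨n - p - 1, by omega⟩
  rw [show p + q + 1 - p = q + 1 by omega] at h1 h2
  simp only [Nat.add_sub_cancel] at h2
  unfold pathD
  rcases lt_trichotomy j p with h | h | h
  · have a1 : j ≤ p := by omega
    have a2 : j + 1 ≤ p := by omega
    have a3 : j - 1 ≤ p := by omega
    have a4 : j + 1 < p + q + 1 := by omega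
    have a5 : j ≠ p := by omega
    simp only [a1, a2, a3, a4, a5, if_true, if_false]
    rcases j with _ | j
    · have := hr 0
      simp at this ⊢
      linear_combination -A * this - A * hU0
    · have := hr (j + 1)
      simp at this ⊢
      linear_combination -A * this
  · subst h
    have a1 : ¬ j + 1 ≤ j := by omega
    have a3 : j - 1 ≤ j := by omega
    have e1 : j + q + 1 - (j + 1) = q := by omega
    simp only [a1, a3, e1, le_refl, if_true, if_false]
    have := hr j
    have key : A * seqU (j + 1) = B * seqU q ∨ j + 1 < j + q + 1 := by
      rcases q with _ | q
      · left; rw [h1, hU0]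
      · right; omega
    rcases j with _ | j
    · rcases q with _ | q
      · simp at *
        linear_combination h2 - A * this - A * hU0 - key
      · simp at *
        linear_combination h2 - A * this - A * hU0
    · rcases q with _ | q
      · simp at *
        linear_combination h2 - A * this - key
      · simp at *
        linear_combination h2 - A * this
  · obtain ⟨t, rfl⟩ : ∃ t, j = p + t + 1 := ⟨j - p - 1, by omega⟩
    obtain ⟨r, rfl⟩ : ∃ r, q = t + 1 + r := ⟨q - t - 1, by omega⟩
    have a1 : ¬ p + t + 1 ≤ p := by omega
    have a2 : ¬ p + t + 1 + 1 ≤ p := by omega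
    have a5 : p + t + 1 ≠ p := by omega
    have a6 : 0 < p + t + 1 := by omega
    have e1 : p + (t + 1 + r) + 1 - (p + t + 1) = r + 1 := by omega
    have e2 : p + (t + 1 + r) + 1 - (p + t + 1 + 1) = r := by omega
    have e3 : p + t + 1 - 1 = p + t := by omega
    have e4 : p + (t + 1 + r) + 1 - (p + t) = r + 2 := by omega
    simp only [a1, a2, a5, a6, e1, e2, e3, e4, if_true, if_false]
    have := hr r
    have key : (if p + t ≤ p then A * seqU (p + t + 1) else B * seqU (r + 2))
        = B * seqU (r + 2) := by
      split_ifs with h'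
      · have : t = 0 := by omega
        subst this
        rw [Nat.add_zero, h1]
        congr 2; omega
      · rfl
    rw [key]
    rcases r with _ | r
    · rw [if_neg (by omega)]
      simp at *
      linear_combination -B * this - B * hU0
    · rw [if_pos (by omega)]
      linear_combination -B * this

theorem sol_edge (n p : ℕ) (hp : p + 1 < n) (A B : ℝ)
    (h1 : A * seqU (p + 2) - B * seqU (n - p - 1) = 1 / 2)
    (h2 : B * seqU (n - p) - A * seqU (p + 1) = - (1 / 2)) (j : ℕ) (hj : j < n) :
    2 * (fun j => if j ≤ p then A * seqU (j + 1) else B * seqU (n - j)) j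
      + pathD n (fun j => if j ≤ p then A * seqU (j + 1) else B * seqU (n - j)) j
      = (if j = p then 1 / 2 else 0) - (if j = p + 1 then 1 / 2 else 0) := by
  have hU0 : seqU 1 = seqU 0 := by simp [seqU]
  have hr := seqU_rec
  obtain ⟨q, rfl⟩ : ∃ q, n = p + q + 2 := ⟨n - p - 2, by omega⟩
  rw [show p + q + 2 - p = q + 2 by omega] at h1 h2
  rw [show q + 2 - 1 = q + 1 by omega] at h1
  unfold pathD
  rcases lt_trichotomy j p with h | h | h
  · have a1 : j ≤ p := by omega
    have a2 : j + 1 ≤ p := by omega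
    have a3 : j - 1 ≤ p := by omega
    have a4 : j + 1 < p + q + 2 := by omega
    have a5 : j ≠ p := by omega
    have a6 : j ≠ p + 1 := by omega
    simp only [a1, a2, a3, a4, a5, a6, if_true, if_false]
    rcases j with _ | j
    · have := hr 0
      simp at this ⊢
      linear_combination -A * this - A * hU0
    · have := hr (j + 1)
      simp at this ⊢
      linear_combination -A * this
  · subst h
    have a1 : ¬ j + 1 ≤ j := by omega
    have a3 : j - 1 ≤ j := by omega
    have a4 : j ≠ j + 1 := by omega
    have a5 : j + 1 < j + q + 2 := by omega
    have e1 : j + q + 2 - (j + 1) = q + 1 := by omega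
    simp only [a1, a3, a4, a5, e1, le_refl, if_true, if_false]
    have := hr j
    rcases j with _ | j
    · simp at *
      linear_combination h1 - A * this - A * hU0
    · simp at *
      linear_combination h1 - A * this
  · obtain ⟨t, rfl⟩ : ∃ t, j = p + t + 1 := ⟨j - p - 1, by omega⟩
    obtain ⟨r, rfl⟩ : ∃ r, q = t + r := ⟨q - t, by omega⟩
    have a1 : ¬ p + t + 1 ≤ p := by omega
    have a2 : ¬ p + t + 1 + 1 ≤ p := by omega
    have a5 : p + t + 1 ≠ p := by omega
    have a6 : 0 < p + t + 1 := by omega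
    have e1 : p + (t + r) + 2 - (p + t + 1) = r + 1 := by omega
    have e2 : p + (t + r) + 2 - (p + t + 1 + 1) = r := by omega
    have e3 : p + t + 1 - 1 = p + t := by omega
    have e4 : p + (t + r) + 2 - (p + t) = r + 2 := by omega
    simp only [a1, a2, a5, a6, e1, e2, e3, e4, if_true, if_false]
    have := hr r
    have key : (if p + t ≤ p then A * seqU (p + t + 1) else B * seqU (r + 2))
        = B * seqU (r + 2) + (if p + t + 1 = p + 1 then 1 / 2 else 0) := by
      by_cases h' : t = 0
      · subst h'
        simp at h2 ⊢
        linarith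
      · rw [if_neg (by omega), if_neg (by omega), add_zero]
    rw [key]
    rcases r with _ | r
    · rw [if_neg (by omega)]
      simp at *
      linear_combination -B * this - B * hU0
    · rw [if_pos (by omega)]
      linear_combination -B * this

theorem step_sol (n p : ℕ) (hp : p + 1 < n) (j : ℕ) (hj : j < n) :
    pathD n (fun j => if j ≤ p then (1 / 2 : ℝ) else 0) j
      = (if j = p then 1 / 2 else 0) - (if j = p + 1 then 1 / 2 else 0) := by
  unfold pathD
  simp only
  split_ifs <;> first | omega | norm_num

theorem W_pos (a b : ℕ) : 0 < seqU (a + 2) * seqU (b + 1) - seqU (a + 1) * seqU b := by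
  have h1 := seqU_lt a
  have h2 := seqU_pos b
  have h3 := seqU_pos (a + 1)
  nlinarith [mul_pos (sub_pos.2 h1) (seqU_pos (b + 1)).1, mul_nonneg h3.1.le (sub_nonneg.2 h2.2)]

theorem rung_res (n p : ℕ) (hp : p < n) (i : Fin 2) :
    effRes (ladder n) (i, ⟨p, hp⟩) (1 - i, ⟨p, hp⟩)
      = 2 * seqU (p + 1) * seqU (n - p) /
        (seqU (p + 2) * seqU (n - p) - seqU (p + 1) * seqU (n - p - 1)) := by
  have hW := W_pos p (n - p - 1)
  rw [show n - p - 1 + 1 = n - p by omega] at hW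
  set W := seqU (p + 2) * seqU (n - p) - seqU (p + 1) * seqU (n - p - 1) with hWd
  have hi : 1 - i ≠ i := by fin_cases i <;> simp
  rw [ladder_pot n i (fun j => if j ≤ p then (seqU (n - p) / W) * seqU (j + 1)
    else (seqU (p + 1) / W) * seqU (n - j)) (fun _ => 0)]
  · simp [hi]; ring
  · intro i' j hj
    rw [sol_rung n p hp _ _ (by ring) (by field_simp; rw [hWd]; ring) j hj]
    have : i' = 1 - i ↔ ¬ i' = i := by fin_cases i <;> fin_cases i' <;> simp
    simp only [Prod.mk.injEq, Fin.mk.injEq, pathD, this]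
    by_cases c1 : i' = i <;> by_cases c2 : j = p <;> simp [c1, c2]

theorem edge_res (n p : ℕ) (hp : p + 1 < n) (i : Fin 2) :
    effRes (ladder n) (i, ⟨p, by omega⟩) (i, ⟨p + 1, hp⟩)
      = 1 / 2 + (seqU (p + 1) * (seqU (n - p) - seqU (n - p - 1))
          + (seqU (p + 2) - seqU (p + 1)) * seqU (n - p - 1)) /
        (2 * (seqU (p + 2) * seqU (n - p) - seqU (p + 1) * seqU (n - p - 1))) := by
  have hW := W_pos p (n - p - 1)
  rw [show n - p - 1 + 1 = n - p by omega] at hW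
  set W := seqU (p + 2) * seqU (n - p) - seqU (p + 1) * seqU (n - p - 1) with hWd
  rw [ladder_pot n i (fun j => if j ≤ p then
      ((seqU (n - p) - seqU (n - p - 1)) / (2 * W)) * seqU (j + 1)
    else ((seqU (p + 1) - seqU (p + 2)) / (2 * W)) * seqU (n - j))
      (fun j => if j ≤ p then (1 / 2 : ℝ) else 0)]
  · simp [Nat.sub_add_eq]; field_simp; ring
  · intro i' j hj
    rw [sol_edge n p hp _ _ (by field_simp; rw [hWd]; ring) (by field_simp; rw [hWd]; ring) j hj,
      step_sol n p hp j hj]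
    simp only [Prod.mk.injEq, Fin.mk.injEq]
    split_ifs <;> first | (exfalso; tauto) | (exfalso; omega) | norm_num

theorem effRes_comm {V : Type*} [Fintype V] [DecidableEq V] (G : SimpleGraph V) (x y : V) :
    effRes G x y = effRes G y x := by
  have hs := pinv_symm _ (show (G.lapMatrix ℝ)ᵀ = G.lapMatrix ℝ from G.isSymm_lapMatrix ℝ)
  unfold effRes effResM
  have : pinv (G.lapMatrix ℝ) y x = pinv (G.lapMatrix ℝ) x y := by
    conv_lhs => rw [← hs]
    rfl
  rw [this]; ring

theorem alpha_eq (m : ℕ) : alpha (m + 1) = 2 * seqU (m + 1) / (seqU (m + 2) - seqU (m + 1)) := by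
  have h := rung_res (m + 1) 0 (by omega) 0
  rw [alpha, dif_pos (by omega)]
  refine h.trans ?_
  have e := seqU_rec m
  have e1 : seqU 1 = 1 := rfl
  have e2 : seqU 2 = 3 := by rw [seqU_rec]; norm_num [seqU]
  simp only [Nat.zero_add, Nat.sub_zero, Nat.add_sub_cancel, e1, e2]
  rw [show 3 * seqU (m + 1) - 1 * seqU m = seqU (m + 2) - seqU (m + 1) by rw [e]; ring]
  ring

theorem mid_curv_formula (n k : ℕ) (hk1 : 1 < k) (hkn : k < n) (i : Fin 2) :
    curv (ladder n) (i, ⟨k - 1, by omega⟩)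
      = -(1/2) * (((alpha (k - 1) + 1) * (alpha (n - k) + 1) - 3)
          / ((alpha (k - 1) + 3) * (alpha (n - k) + 3) - 1)) := by
  obtain ⟨p, rfl⟩ : ∃ p, k = p + 2 := ⟨k - 2, by omega⟩
  obtain ⟨q, rfl⟩ : ∃ q, n = p + q + 3 := ⟨n - p - 3, by omega⟩
  have e1 : p + 2 - 1 = p + 1 := by omega
  have e2 : p + q + 3 - (p + 2) = q + 1 := by omega
  simp only [e1, e2]
  have hR := rung_res (p + q + 3) (p + 1) (by omega) i
  have hE1 := edge_res (p + q + 3) (p + 1) (by omega) i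
  have hE2 := edge_res (p + q + 3) p (by omega) i
  rw [effRes_comm] at hE2
  rw [show p + q + 3 - (p + 1) = q + 2 by omega] at hR hE1
  rw [show p + q + 3 - p = q + 3 by omega] at hE2
  rw [show q + 2 - 1 = q + 1 by omega] at hR hE1
  rw [show q + 3 - 1 = q + 2 by omega] at hE2
  unfold curv
  rw [ladder_sum, dif_pos (by omega), dif_pos (by omega)]
  simp only [Nat.add_sub_cancel]
  rw [hR, hE1, hE2, alpha_eq, alpha_eq]
  have r1 : seqU (p + 1 + 2) = 4 * seqU (p + 2) - seqU (p + 1) := seqU_rec _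
  have r2 : seqU (q + 3) = 4 * seqU (q + 2) - seqU (q + 1) := seqU_rec _
  have w := W_pos (p + 1) (q + 1)
  have l1 := seqU_lt p
  have l2 := seqU_lt q
  have p1 := (seqU_pos (p + 1)).1
  have p2 := (seqU_pos (q + 1)).1
  rw [r1] at w ⊢
  rw [r2]
  simp only [show p + 1 + 1 = p + 2 from rfl, show q + 1 + 1 = q + 2 from rfl] at *
  generalize seqU (p + 1) = s at *
  generalize seqU (p + 2) = t at *
  generalize seqU (q + 1) = y at *
  generalize seqU (q + 2) = z at *
  have d1 : t - s ≠ 0 := (sub_pos.2 l1).ne'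
  have d2 : z - y ≠ 0 := (sub_pos.2 l2).ne'
  have w2 : t * (4 * z - y) - s * z = (4 * t - s) * z - t * y := by ring
  have hden : (2 * s / (t - s) + 3) * (2 * y / (z - y) + 3) - 1
      = 2 * ((4 * t - s) * z - t * y) / ((t - s) * (z - y)) := by
    field_simp; ring
  rw [w2, hden]
  generalize hw : (4 * t - s) * z - t * y = W at *
  have hW : W ≠ 0 := w.ne'
  field_simp
  rw [← hw]
  ring
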